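/- Let n ≥ 3, 0 < δ ≤ 1. There exists η = η(n,δ) > 0 such that for all f ∈ 𝒮(ℝⁿ): ‖ |D|^{(3−n)/2 − 1} ( ⟨x⟩^{−1−δ} f ) ‖_{L²(ℝⁿ)} ≤ η ‖ |D|^{(3−n)/2} f ‖_{L²(ℝⁿ)}, where |D|^s is the Fourier multiplier with symbol |ξ|^s. -/

import Mathlib

open MeasureTheory FourierTransform SchwartzMap

/-- The Fourier multiplier `|D|^s` with symbol `|ξ|^s`. -/
noncomputable def absD {n : ℕ} (s : ℝ) (f : EuclideanSpace ℝ (Fin n) → ℂ) :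
    EuclideanSpace ℝ (Fin n) → ℂ :=
  𝓕⁻ fun ξ => ((‖ξ‖ ^ s : ℝ) : ℂ) * 𝓕 f ξ

open scoped ENNReal

theorem ennreal_rpow_le_rpow_of_nonpos {x y : ℝ≥0∞} {z : ℝ} (hz : z ≤ 0) (h : x ≤ y) :
    y ^ z ≤ x ^ z := by
  rw [← neg_neg z, ENNReal.rpow_neg y, ENNReal.rpow_neg x]
  exact ENNReal.inv_le_inv.2 (ENNReal.rpow_le_rpow h (by linarith))

section
variable {V : Type*} [NormedAddCommGroup V] [InnerProductSpace ℝ V] [FiniteDimensional ℝ V]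
  [MeasurableSpace V] [BorelSpace V]

theorem enorm_rpow_eq_ofReal {V : Type*} [NormedAddCommGroup V] {x : V} (hx : x ≠ 0) (s : ℝ) :
    ‖x‖ₑ ^ s = ENNReal.ofReal (‖x‖ ^ s) := by
  rw [← ofReal_norm, ENNReal.ofReal_rpow_of_pos (norm_pos_iff.2 hx)]

/-- Scaling of Lebesgue integrals. -/
theorem lintegral_eq_mul_lintegral_comp_smul (f : V → ℝ≥0∞) {r : ℝ} (hr : 0 < r) :
    ∫⁻ x, f x = ENNReal.ofReal r ^ (Module.finrank ℝ V : ℝ) * ∫⁻ x, f (r • x) := by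
  have hemb : MeasurableEmbedding (fun x : V => r • x) :=
    (Homeomorph.smulOfNeZero r hr.ne').measurableEmbedding
  rw [← hemb.lintegral_map, Measure.map_addHaar_smul _ hr.ne', lintegral_smul_measure, smul_eq_mul,
    ← mul_assoc, abs_of_pos (by positivity), ENNReal.rpow_natCast, ← ENNReal.ofReal_pow hr.le,
    ← ENNReal.ofReal_mul (by positivity), mul_inv_cancel₀ (by positivity)]
  simp

/-- A product of powers of the norm whose exponents are integrable at the origin and at infinity
has finite integral. -/
theorem lintegral_max_rpow_mul_rpow_lt_top {α β : ℝ} (hd : 1 ≤ Module.finrank ℝ V) (_hα : 0 ≤ α)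
    (hβ : β < Module.finrank ℝ V) (hαβ : Module.finrank ℝ V < α + β) :
    ∫⁻ x : V, max (1 / 2) ‖x‖ₑ ^ (-α) * ‖x‖ₑ ^ (-β) < ∞ := by
  have : Nontrivial V := Module.nontrivial_of_finrank_pos (R := ℝ) (by omega)
  have h1 : IntegrableOn (fun x : V => ‖x‖ ^ (-β)) (Metric.ball 0 1) :=
    integrableOn_ball_of_norm_le_rpow (C := 1) hd hβ
      (.of_forall fun x => by rw [one_mul, Real.norm_of_nonneg (by positivity)])
      (measurable_norm.pow_const _).aestronglyMeasurable
  have h2 : Integrable (fun x : V => (1 + ‖x‖) ^ (-(α + β))) := integrable_one_add_norm hαβ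
  have hpt : ∀ᵐ x : V, max (1 / 2) ‖x‖ₑ ^ (-α) * ‖x‖ₑ ^ (-β) ≤
      ENNReal.ofReal (2 ^ α) * (Metric.ball (0 : V) 1).indicator
        (fun x => ENNReal.ofReal (‖x‖ ^ (-β))) x
      + ENNReal.ofReal (2 ^ (α + β)) * ENNReal.ofReal ((1 + ‖x‖) ^ (-(α + β))) := by
    have h0 : ∀ᵐ x : V, x ≠ 0 := by simp [ae_iff, measure_singleton]
    filter_upwards [h0] with x hx
    have hxp : 0 < ‖x‖ := norm_pos_iff.2 hx
    rw [enorm_rpow_eq_ofReal hx]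
    by_cases hb : ‖x‖ < 1
    · rw [Set.indicator_of_mem (by simpa using hb)]
      refine le_add_right ?_
      gcongr
      calc max (1 / 2) ‖x‖ₑ ^ (-α) ≤ (1 / 2 : ℝ≥0∞) ^ (-α) :=
            ennreal_rpow_le_rpow_of_nonpos (by linarith) (le_max_left _ _)
        _ = _ := by
          rw [one_div, ENNReal.inv_rpow, ENNReal.rpow_neg, inv_inv,
            ← ENNReal.ofReal_rpow_of_pos two_pos]
          simp
    · refine le_add_left ?_
      push Not at hb
      calc max (1 / 2) ‖x‖ₑ ^ (-α) * ENNReal.ofReal (‖x‖ ^ (-β))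
          ≤ ‖x‖ₑ ^ (-α) * ENNReal.ofReal (‖x‖ ^ (-β)) := by
            gcongr ?_ * _
            exact ennreal_rpow_le_rpow_of_nonpos (by linarith) (le_max_right _ _)
        _ = ENNReal.ofReal (‖x‖ ^ (-(α + β))) := by
            rw [enorm_rpow_eq_ofReal hx, ← ENNReal.ofReal_mul (by positivity),
              ← Real.rpow_add hxp]
            ring_nf
        _ ≤ _ := by
            rw [← ENNReal.ofReal_mul (by positivity)]
            refine ENNReal.ofReal_le_ofReal ?_
            have : (2 : ℝ) ^ (α + β) = (1 / 2) ^ (-(α + β)) := by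
              rw [one_div, Real.inv_rpow two_pos.le, Real.rpow_neg two_pos.le, inv_inv]
            rw [this, ← Real.mul_rpow (by norm_num) (by positivity)]
            exact Real.rpow_le_rpow_of_nonpos (by positivity) (by linarith) (by linarith)
  refine (lintegral_mono_ae hpt).trans_lt ?_
  rw [lintegral_add_right' _ (by fun_prop), lintegral_const_mul' _ _ ENNReal.ofReal_ne_top,
    lintegral_const_mul' _ _ ENNReal.ofReal_ne_top, lintegral_indicator measurableSet_ball]
  refine ENNReal.add_lt_top.2 ⟨ENNReal.mul_lt_top ENNReal.ofReal_lt_top ?_,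
    ENNReal.mul_lt_top ENNReal.ofReal_lt_top ?_⟩
  · exact h1.setLIntegral_lt_top
  · exact h2.lintegral_lt_top

theorem lintegral_max_rpow_mul_rpow_eq (α β : ℝ) {r : ℝ} (hr : 0 < r) :
    ∫⁻ x : V, max (ENNReal.ofReal r / 2) ‖x‖ₑ ^ (-α) * ‖x‖ₑ ^ (-β) =
      ENNReal.ofReal r ^ (Module.finrank ℝ V - α - β) *
        ∫⁻ x : V, max (1 / 2) ‖x‖ₑ ^ (-α) * ‖x‖ₑ ^ (-β) := by
  have hr0 : ENNReal.ofReal r ≠ 0 := by simpa using hr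
  rw [lintegral_eq_mul_lintegral_comp_smul _ hr]
  have : ∀ x : V, max (ENNReal.ofReal r / 2) ‖r • x‖ₑ ^ (-α) * ‖r • x‖ₑ ^ (-β) =
      ENNReal.ofReal r ^ (-α - β) * (max (1 / 2) ‖x‖ₑ ^ (-α) * ‖x‖ₑ ^ (-β)) := by
    intro x
    have e1 : ‖r • x‖ₑ = ENNReal.ofReal r * ‖x‖ₑ := by
      rw [enorm_smul, Real.enorm_of_nonneg hr.le]
    have e2 : max (ENNReal.ofReal r / 2) ‖r • x‖ₑ = ENNReal.ofReal r * max (1 / 2) ‖x‖ₑ := by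
      rw [e1, mul_max, mul_one_div]
    rw [e2, e1, sub_eq_add_neg, ENNReal.rpow_add _ _ hr0 ENNReal.ofReal_ne_top,
      ENNReal.mul_rpow_of_ne_top ENNReal.ofReal_ne_top (by simp),
      ENNReal.mul_rpow_of_ne_top ENNReal.ofReal_ne_top (by simp)]
    ring
  simp_rw [this]
  rw [lintegral_const_mul' _ _ (by finiteness), ← mul_assoc,
    ← ENNReal.rpow_add _ _ hr0 ENNReal.ofReal_ne_top]
  ring_nf

/-- The convolution of two homogeneous kernels. -/
theorem exists_lintegral_enorm_sub_rpow_mul_le {α β : ℝ} (hd : 1 ≤ Module.finrank ℝ V)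
    (hα0 : 0 ≤ α) (hα : α < Module.finrank ℝ V)
    (hβ0 : 0 ≤ β) (hβ : β < Module.finrank ℝ V) (hαβ : Module.finrank ℝ V < α + β) :
    ∃ C : ℝ≥0∞, C ≠ ∞ ∧ ∀ ξ : V, ξ ≠ 0 →
      ∫⁻ η, ‖ξ - η‖ₑ ^ (-α) * ‖η‖ₑ ^ (-β) ≤ C * ‖ξ‖ₑ ^ (Module.finrank ℝ V - α - β) := by
  refine ⟨(∫⁻ x : V, max (1 / 2) ‖x‖ₑ ^ (-α) * ‖x‖ₑ ^ (-β)) +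
    ∫⁻ x : V, max (1 / 2) ‖x‖ₑ ^ (-β) * ‖x‖ₑ ^ (-α), ENNReal.add_ne_top.2
    ⟨(lintegral_max_rpow_mul_rpow_lt_top hd hα0 hβ hαβ).ne,
      (lintegral_max_rpow_mul_rpow_lt_top hd hβ0 hα (by linarith)).ne⟩, fun ξ hξ => ?_⟩
  have hr : 0 < ‖ξ‖ := norm_pos_iff.2 hξ
  have hpt : ∀ η : V, ‖ξ - η‖ₑ ^ (-α) * ‖η‖ₑ ^ (-β) ≤
      max (‖ξ‖ₑ / 2) ‖η‖ₑ ^ (-α) * ‖η‖ₑ ^ (-β) +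
      max (‖ξ‖ₑ / 2) ‖ξ - η‖ₑ ^ (-β) * ‖ξ - η‖ₑ ^ (-α) := by
    intro η
    have htri : ‖ξ‖ₑ ≤ ‖ξ - η‖ₑ + ‖η‖ₑ := by simpa using enorm_add_le (ξ - η) η
    rcases le_total ‖η‖ₑ ‖ξ - η‖ₑ with h | h
    · refine le_add_right ?_
      gcongr ?_ * _
      refine ennreal_rpow_le_rpow_of_nonpos (by linarith) (max_le ?_ h)
      refine ENNReal.div_le_of_le_mul ?_
      rw [mul_two]; exact htri.trans (by gcongr)
    · refine le_add_left ?_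
      rw [mul_comm]
      gcongr ?_ * _
      refine ennreal_rpow_le_rpow_of_nonpos (by linarith) (max_le ?_ h)
      refine ENNReal.div_le_of_le_mul ?_
      rw [mul_two]; exact htri.trans (by gcongr)
  refine (lintegral_mono hpt).trans ?_
  rw [lintegral_add_left (by fun_prop), lintegral_sub_left_eq_self
    (fun y : V => max (‖ξ‖ₑ / 2) ‖y‖ₑ ^ (-β) * ‖y‖ₑ ^ (-α)) ξ, ← ofReal_norm ξ,
    lintegral_max_rpow_mul_rpow_eq α β hr, lintegral_max_rpow_mul_rpow_eq β α hr, add_mul,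
    sub_right_comm _ β α, mul_comm, mul_comm (_ ^ _)]
end

section
variable {V : Type*} [NormedAddCommGroup V] [InnerProductSpace ℝ V] [FiniteDimensional ℝ V]
  [MeasurableSpace V] [BorelSpace V]

theorem integral_fourier_mul_eq_of_integrable {f g : V → ℂ} (hf : Integrable f)
    (hg : Integrable g) : ∫ ξ, 𝓕 f ξ * g ξ = ∫ x, f x * 𝓕 g x := by
  simpa using! VectorFourier.integral_bilin_fourierIntegral_eq_flip (.mul ℂ ℂ) (L := innerₗ V)
    Real.continuous_fourierChar continuous_inner hf hg

theorem continuous_fourier_of_integrable {h : V → ℂ} (h1 : Integrable h) : Continuous (𝓕 h) :=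
  VectorFourier.fourierIntegral_continuous Real.continuous_fourierChar
    (by exact continuous_inner) h1

/-- Plancherel's theorem on `L¹ ∩ L²`. -/
theorem eLpNorm_fourier_eq {h : V → ℂ} (h1 : Integrable h) (h2 : MemLp h 2) :
    eLpNorm (𝓕 h) 2 = eLpNorm h 2 := by
  set H : Lp ℂ 2 (volume : Measure V) := h2.toLp h
  have key : (𝓕 H : Lp ℂ 2 (volume : Measure V)) =ᵐ[volume] 𝓕 h := by
    have hc := continuous_fourier_of_integrable h1
    refine ae_eq_of_integral_contDiff_smul_eq
      ((Lp.memLp (𝓕 H)).locallyIntegrable (by norm_num)) hc.locallyIntegrable ?_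
    intro g hg hgs
    have hgs' : HasCompactSupport (fun x => (g x : ℂ)) := hgs.comp_left (g := Complex.ofReal) rfl
    let G : 𝓢(V, ℂ) := hgs'.toSchwartzMap (Complex.ofRealCLM.contDiff.comp hg)
    have e1 := congrArg (fun T : 𝓢'(V, ℂ) => T G) (Lp.fourier_toTemperedDistribution_eq H)
    simp only [TemperedDistribution.fourier_apply, Lp.toTemperedDistribution_apply] at e1
    have e2 : ∫ x, 𝓕 G x • H x = ∫ x, 𝓕 (G : V → ℂ) x * h x := by
      refine integral_congr_ae ?_
      filter_upwards [h2.coeFn_toLp] with x hx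
      rw [hx, SchwartzMap.fourier_coe, smul_eq_mul]
    rw [e2, integral_fourier_mul_eq_of_integrable G.integrable h1] at e1
    have hG : ∀ x, G x = (g x : ℂ) := fun _ => rfl
    simpa [hG] using e1.symm
  rw [← eLpNorm_congr_ae key, ← eLpNorm_congr_ae h2.coeFn_toLp, ← Lp.enorm_def, ← Lp.enorm_def,
    enorm_eq_iff_norm_eq, Lp.norm_fourier_eq]

theorem eLpNorm_fourierInv_eq {h : V → ℂ} (h1 : Integrable h) (h2 : MemLp h 2) :
    eLpNorm (𝓕⁻ h) 2 = eLpNorm h 2 := by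
  have : 𝓕⁻ h = 𝓕 h ∘ (Neg.neg : V → V) := by
    ext x; exact Real.fourierInv_eq_fourier_neg h x
  rw [this, eLpNorm_comp_measurePreserving
    (continuous_fourier_of_integrable h1).aestronglyMeasurable
    (Measure.measurePreserving_neg volume), eLpNorm_fourier_eq h1 h2]

/-- The Fourier transform of a Gaussian times a Schwartz function, as a convolution. -/
theorem fourier_gaussian_mul (f : 𝓢(V, ℂ)) {t : ℝ} (ht : 0 < t) (ξ : V) :
    𝓕 (fun x => (Real.exp (-(t * ‖x‖ ^ 2)) : ℂ) * f x) ξ =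
      ∫ η, (((Real.pi / t) ^ ((Module.finrank ℝ V : ℝ) / 2) *
        Real.exp (-(Real.pi ^ 2 * ‖ξ - η‖ ^ 2 / t)) : ℝ) : ℂ) * 𝓕 (f : V → ℂ) η := by
  have htC : 0 < (t : ℂ).re := by simpa
  have hψ : Integrable (fun v : V => Complex.exp (-(t : ℂ) * ‖v‖ ^ 2
      + 2 * Real.pi * Complex.I * inner ℝ ξ v)) := by
    simpa using GaussianFourier.integrable_cexp_neg_mul_sq_norm_add htC
      (2 * Real.pi * Complex.I) ξ
  have hF : Integrable (𝓕 (f : V → ℂ)) := by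
    rw [← SchwartzMap.fourier_coe]; exact (𝓕 f).integrable
  have h := integral_fourier_mul_eq_of_integrable hψ hF
  simp only [fourier_gaussian_innerProductSpace' htC] at h
  have e1 : 𝓕 (fun x => (Real.exp (-(t * ‖x‖ ^ 2)) : ℂ) * f x) ξ =
      ∫ v, Complex.exp (-(t : ℂ) * ‖v‖ ^ 2
      + 2 * Real.pi * Complex.I * inner ℝ ξ v) * 𝓕 (𝓕 (f : V → ℂ)) v := by
    rw [Real.fourier_eq', ← integral_neg_eq_self]
    refine integral_congr_ae (.of_forall fun x => ?_)
    have : 𝓕 (𝓕 (f : V → ℂ)) x = f (-x) := by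
      rw [← SchwartzMap.fourier_coe, ← neg_neg x, ← Real.fourierInv_eq_fourier_neg,
        ← SchwartzMap.fourierInv_coe, FourierTransform.fourierInv_fourier_eq, neg_neg]
    simp only [this, Complex.exp_add, smul_eq_mul, real_inner_comm ξ, norm_neg, inner_neg_right]
    push_cast
    rw [← mul_assoc, mul_comm (Complex.exp _) (Complex.exp _)]
    congr 3 <;> ring_nf
  rw [e1, ← h]
  refine integral_congr_ae (.of_forall fun x => ?_)
  simp only
  push_cast
  rw [Complex.ofReal_cpow (by positivity)]
  push_cast
  congr 3
  ring_nf
end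

section
variable {V : Type*} [NormedAddCommGroup V] [InnerProductSpace ℝ V] [FiniteDimensional ℝ V]
  [MeasurableSpace V] [BorelSpace V]

/-- Weighted Cauchy-Schwarz inequality. -/
theorem sq_lintegral_mul_le {α : Type*} [MeasurableSpace α] {μ : Measure α} {k w F : α → ℝ≥0∞}
    (hk : AEMeasurable k μ) (hw : AEMeasurable w μ) (hF : AEMeasurable F μ)
    (hw0 : ∀ᵐ x ∂μ, w x ≠ 0) (hw1 : ∀ᵐ x ∂μ, w x ≠ ∞) :
    (∫⁻ x, k x * F x ∂μ) ^ (2 : ℝ) ≤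
      (∫⁻ x, k x * (w x)⁻¹ ∂μ) * ∫⁻ x, k x * (w x * F x ^ (2 : ℝ)) ∂μ := by
  have h := ENNReal.lintegral_mul_le_Lp_mul_Lq μ Real.HolderConjugate.two_two
    (f := fun x => (k x * (w x)⁻¹) ^ (1 / 2 : ℝ))
    (g := fun x => (k x * (w x * F x ^ (2 : ℝ))) ^ (1 / 2 : ℝ)) (by fun_prop) (by fun_prop)
  have h2 : ∀ y : ℝ≥0∞, (y ^ (1 / 2 : ℝ)) ^ (2 : ℝ) = y := fun y => by
    rw [← ENNReal.rpow_mul]; norm_num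
  simp only [h2, Pi.mul_apply] at h
  have e : ∫⁻ x, k x * F x ∂μ = ∫⁻ x, (k x * (w x)⁻¹) ^ (1 / 2 : ℝ) *
      (k x * (w x * F x ^ (2 : ℝ))) ^ (1 / 2 : ℝ) ∂μ := by
    refine lintegral_congr_ae ?_
    filter_upwards [hw0, hw1] with x h0 h1
    rw [← ENNReal.mul_rpow_of_nonneg _ _ (by norm_num)]
    have : k x * (w x)⁻¹ * (k x * (w x * F x ^ (2 : ℝ))) = (k x * F x) ^ (2 : ℝ) := by
      calc _ = k x * k x * ((w x)⁻¹ * w x) * F x ^ (2 : ℝ) := by ring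
        _ = _ := by
          rw [ENNReal.inv_mul_cancel h0 h1, mul_one, ENNReal.mul_rpow_of_nonneg _ _ (by norm_num)]
          simp [pow_two]
    rw [this, ← ENNReal.rpow_mul]; norm_num
  calc _ ≤ ((∫⁻ x, k x * (w x)⁻¹ ∂μ) ^ (1 / 2 : ℝ) *
        (∫⁻ x, k x * (w x * F x ^ (2 : ℝ)) ∂μ) ^ (1 / 2 : ℝ)) ^ (2 : ℝ) := by
          rw [e]; gcongr
    _ = _ := by rw [ENNReal.mul_rpow_of_nonneg _ _ (by norm_num), h2, h2]

/-- A weighted Hardy-Littlewood-Sobolev (Stein-Weiss) inequality in `L²`. -/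
theorem exists_lintegral_sq_rieszPotential_le (hd : 2 ≤ Module.finrank ℝ V) :
    ∃ C : ℝ≥0∞, C ≠ ∞ ∧ ∀ F : V → ℝ≥0∞, Measurable F →
      ∫⁻ ξ, ‖ξ‖ₑ ^ (1 - Module.finrank ℝ V : ℝ) *
          (∫⁻ η, ‖ξ - η‖ₑ ^ (-(Module.finrank ℝ V - 1) : ℝ) * F η) ^ (2 : ℝ) ≤
        C * ∫⁻ η, ‖η‖ₑ ^ (3 - Module.finrank ℝ V : ℝ) * F η ^ (2 : ℝ) := by
  have : Nontrivial V := Module.nontrivial_of_finrank_pos (R := ℝ) (by omega)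
  set d := ((Module.finrank ℝ V : ℕ) : ℝ) with hd'
  have hd2 : 2 ≤ d := by rw [hd']; exact_mod_cast hd
  obtain ⟨C₁, hC₁, h₁⟩ := exists_lintegral_enorm_sub_rpow_mul_le (V := V) (α := d - 1) (β := 3 / 2)
    (by omega) (by linarith) (by linarith) (by norm_num) (by linarith) (by linarith)
  obtain ⟨C₂, hC₂, h₂⟩ := exists_lintegral_enorm_sub_rpow_mul_le (V := V) (α := d - 1)
    (β := d - 1 / 2) (by omega) (by linarith) (by linarith) (by linarith) (by linarith)
    (by linarith)
  have h0 : ∀ᵐ x : V, x ≠ 0 := by simp [ae_iff, measure_singleton]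
  have hadd : ∀ {x : V}, x ≠ 0 → ∀ s t : ℝ, ‖x‖ₑ ^ s * ‖x‖ₑ ^ t = ‖x‖ₑ ^ (s + t) := fun hx s t =>
    (ENNReal.rpow_add _ _ (by simpa using hx) (by simp)).symm
  refine ⟨C₁ * C₂, ENNReal.mul_ne_top hC₁ hC₂, fun F hF => ?_⟩
  calc ∫⁻ ξ, ‖ξ‖ₑ ^ (1 - d) * (∫⁻ η, ‖ξ - η‖ₑ ^ (-(d - 1)) * F η) ^ (2 : ℝ)
      ≤ ∫⁻ ξ, C₁ * ∫⁻ η, ‖ξ‖ₑ ^ (-(d - 1 / 2)) *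
          (‖ξ - η‖ₑ ^ (-(d - 1)) * (‖η‖ₑ ^ (3 / 2 : ℝ) * F η ^ (2 : ℝ))) := by
        refine lintegral_mono_ae ?_
        filter_upwards [h0] with ξ hξ
        rw [lintegral_const_mul _ (by fun_prop)]
        calc _ ≤ ‖ξ‖ₑ ^ (1 - d) * ((∫⁻ η, ‖ξ - η‖ₑ ^ (-(d - 1)) * (‖η‖ₑ ^ (3 / 2 : ℝ))⁻¹) *
              ∫⁻ η, ‖ξ - η‖ₑ ^ (-(d - 1)) * (‖η‖ₑ ^ (3 / 2 : ℝ) * F η ^ (2 : ℝ))) := by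
              gcongr
              refine sq_lintegral_mul_le (by fun_prop) (by fun_prop) (by fun_prop) ?_ ?_
              · filter_upwards [h0] with η hη
                simp [hη]
              · exact .of_forall fun η => by finiteness
          _ ≤ ‖ξ‖ₑ ^ (1 - d) * ((C₁ * ‖ξ‖ₑ ^ (d - (d - 1) - 3 / 2)) *
              ∫⁻ η, ‖ξ - η‖ₑ ^ (-(d - 1)) * (‖η‖ₑ ^ (3 / 2 : ℝ) * F η ^ (2 : ℝ))) := by
              gcongr
              simpa only [ENNReal.rpow_neg _ (3 / 2 : ℝ)] using h₁ ξ hξ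
          _ = C₁ * ((‖ξ‖ₑ ^ (1 - d) * ‖ξ‖ₑ ^ (d - (d - 1) - 3 / 2)) *
              ∫⁻ η, ‖ξ - η‖ₑ ^ (-(d - 1)) * (‖η‖ₑ ^ (3 / 2 : ℝ) * F η ^ (2 : ℝ))) := by ring
          _ = _ := by
              rw [hadd hξ]
              ring_nf
    _ = C₁ * ∫⁻ η, (‖η‖ₑ ^ (3 / 2 : ℝ) * F η ^ (2 : ℝ)) *
          ∫⁻ ξ, ‖η - ξ‖ₑ ^ (-(d - 1)) * ‖ξ‖ₑ ^ (-(d - 1 / 2)) := by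
        rw [lintegral_const_mul' _ _ hC₁, lintegral_lintegral_swap (by fun_prop)]
        congr 1
        refine lintegral_congr fun η => ?_
        rw [← lintegral_const_mul _ (by fun_prop)]
        refine lintegral_congr fun ξ => ?_
        rw [enorm_sub_rev]
        ring
    _ ≤ C₁ * ∫⁻ η, C₂ * (‖η‖ₑ ^ (3 - d) * F η ^ (2 : ℝ)) := by
        gcongr C₁ * ?_
        refine lintegral_mono_ae ?_
        filter_upwards [h0] with η hη
        calc _ ≤ (‖η‖ₑ ^ (3 / 2 : ℝ) * F η ^ (2 : ℝ)) *
              (C₂ * ‖η‖ₑ ^ (d - (d - 1) - (d - 1 / 2))) := by gcongr; exact h₂ η hη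
          _ = C₂ * ((‖η‖ₑ ^ (3 / 2 : ℝ) * ‖η‖ₑ ^ (d - (d - 1) - (d - 1 / 2))) *
              F η ^ (2 : ℝ)) := by ring
          _ = _ := by rw [hadd hη]; ring_nf
    _ = _ := by rw [lintegral_const_mul' _ _ hC₂, mul_assoc]
end

section

theorem integrableOn_rpow_mul_exp_neg_mul {p r : ℝ} (hp : 0 < p) (hr : 0 < r) :
    IntegrableOn (fun t => t ^ (p - 1) * Real.exp (-(r * t))) (Set.Ioi 0) := by
  have := integrableOn_rpow_mul_exp_neg_mul_rpow (p := 1) (s := p - 1) (b := r) (by linarith)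
    one_pos hr
  simpa using this

/-- The subordination integral of Gaussians giving a Riesz kernel. -/
theorem lintegral_rpow_mul_exp_neg_div {q r : ℝ} (hq : 0 < q) (hr : 0 < r) :
    ∫⁻ t in Set.Ioi 0, ENNReal.ofReal (t ^ (-q - 1) * Real.exp (-(r / t))) =
      ENNReal.ofReal (r ^ (-q) * Real.Gamma q) := by
  have hcongr : Set.EqOn (fun t : ℝ => (|(-1 : ℝ)| * t ^ ((-1 : ℝ) - 1)) •
      ((t ^ (-1 : ℝ)) ^ (q - 1) * Real.exp (-(r * t ^ (-1 : ℝ)))))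
      (fun t : ℝ => t ^ (-q - 1) * Real.exp (-(r / t))) (Set.Ioi 0) := by
    intro t ht
    have ht : 0 < t := ht
    simp only [abs_neg, abs_one, one_mul, smul_eq_mul]
    rw [← mul_assoc, ← Real.rpow_mul ht.le, ← Real.rpow_add ht, Real.rpow_neg_one, div_eq_mul_inv]
    ring_nf
  have hi := (integrableOn_Ioi_comp_rpow_iff
    (fun t : ℝ => t ^ (q - 1) * Real.exp (-(r * t))) (p := -1) (by norm_num)).2
    (integrableOn_rpow_mul_exp_neg_mul hq hr)
  have he := integral_comp_rpow_Ioi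
    (fun t : ℝ => t ^ (q - 1) * Real.exp (-(r * t))) (p := -1) (by norm_num)
  rw [integrableOn_congr_fun hcongr measurableSet_Ioi] at hi
  rw [setIntegral_congr_fun measurableSet_Ioi hcongr,
    Real.integral_rpow_mul_exp_neg_mul_Ioi hq hr] at he
  rw [← ofReal_integral_eq_lintegral_ofReal hi
    (ae_restrict_of_forall_mem measurableSet_Ioi fun t (ht : 0 < t) => by positivity), he,
    one_div, Real.inv_rpow hr.le, Real.rpow_neg hr.le]

/-- The density of the Gaussian mixture representing `(1 + ‖x‖²) ^ (-p)`. -/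
noncomputable def besselDensity (p t : ℝ) : ℝ :=
  (Real.Gamma p)⁻¹ * (t ^ (p - 1) * Real.exp (-t))

@[fun_prop]
theorem measurable_besselDensity (p : ℝ) : Measurable (besselDensity p) := by
  unfold besselDensity; fun_prop

theorem besselDensity_nonneg {p t : ℝ} (hp : 0 < p) (ht : 0 < t) : 0 ≤ besselDensity p t := by
  have := Real.Gamma_pos_of_pos hp
  unfold besselDensity; positivity

theorem integrableOn_besselDensity {p : ℝ} (hp : 0 < p) :
    IntegrableOn (besselDensity p) (Set.Ioi 0) := by
  have := (integrableOn_rpow_mul_exp_neg_mul hp one_pos).const_mul (Real.Gamma p)⁻¹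
  simpa [besselDensity, IntegrableOn] using! this

theorem besselDensity_le {p t : ℝ} (hp : 1 / 2 ≤ p) (hp1 : p ≤ 1) (ht : 0 < t) :
    besselDensity p t ≤ (Real.Gamma p)⁻¹ * t ^ (-(1 / 2) : ℝ) := by
  have := Real.Gamma_pos_of_pos (show 0 < p by linarith)
  unfold besselDensity
  gcongr
  have e : t ^ (p - 1) = t ^ (-(1 / 2) : ℝ) * t ^ (p - 1 / 2) := by
    rw [← Real.rpow_add ht]; ring_nf
  rw [e, mul_assoc]
  refine mul_le_of_le_one_right (by positivity) ?_
  rw [Real.exp_neg, ← div_eq_mul_inv, div_le_one (Real.exp_pos _)]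
  rcases le_total t 1 with h | h
  · exact (Real.rpow_le_one ht.le h (by linarith)).trans (Real.one_le_exp ht.le)
  · calc t ^ (p - 1 / 2) ≤ t ^ (1 : ℝ) := Real.rpow_le_rpow_of_exponent_le h (by linarith)
      _ = t := Real.rpow_one t
      _ ≤ Real.exp t := by linarith [Real.add_one_le_exp t]

theorem integral_besselDensity_mul_exp {p s : ℝ} (hp : 0 < p) (hs : 0 ≤ s) :
    ∫ t in Set.Ioi 0, besselDensity p t * Real.exp (-(t * s)) = (1 + s) ^ (-p) := by
  have h := Real.integral_rpow_mul_exp_neg_mul_Ioi hp (show 0 < 1 + s by linarith)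
  have e : ∀ t, besselDensity p t * Real.exp (-(t * s)) =
      (Real.Gamma p)⁻¹ * (t ^ (p - 1) * Real.exp (-((1 + s) * t))) := by
    intro t
    rw [besselDensity, mul_assoc, mul_assoc, ← Real.exp_add]
    ring_nf
  simp_rw [e]
  rw [integral_const_mul, h, one_div, Real.inv_rpow (by linarith), Real.rpow_neg (by linarith)]
  field_simp [(Real.Gamma_pos_of_pos hp).ne']

end

section
variable {V : Type*} [NormedAddCommGroup V] [InnerProductSpace ℝ V] [FiniteDimensional ℝ V]
  [MeasurableSpace V] [BorelSpace V]

/-- The Bessel kernel is dominated by the Riesz kernel of order one. -/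
theorem exists_lintegral_besselDensity_mul_gaussian_le {V : Type*} [NormedAddCommGroup V]
    {d p : ℝ} (hd : 1 < d) (hp : 1 / 2 ≤ p)
    (hp1 : p ≤ 1) :
    ∃ C : ℝ≥0∞, C ≠ ∞ ∧ ∀ ζ : V, ζ ≠ 0 →
      ∫⁻ t in Set.Ioi 0, ENNReal.ofReal (besselDensity p t * ((Real.pi / t) ^ (d / 2) *
        Real.exp (-(Real.pi ^ 2 * ‖ζ‖ ^ 2 / t)))) ≤ C * ‖ζ‖ₑ ^ (-(d - 1)) := by
  have hΓ := Real.Gamma_pos_of_pos (show 0 < p by linarith)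
  refine ⟨ENNReal.ofReal ((Real.Gamma p)⁻¹ * Real.pi ^ (d / 2)) * ENNReal.ofReal
    ((Real.pi ^ 2) ^ (-((d - 1) / 2)) * Real.Gamma ((d - 1) / 2)), by finiteness, fun ζ hζ => ?_⟩
  have hζp : 0 < ‖ζ‖ := norm_pos_iff.2 hζ
  calc _ ≤ ∫⁻ t in Set.Ioi 0, ENNReal.ofReal ((Real.Gamma p)⁻¹ * Real.pi ^ (d / 2)) *
        ENNReal.ofReal (t ^ (-((d - 1) / 2) - 1) * Real.exp (-(Real.pi ^ 2 * ‖ζ‖ ^ 2 / t))) := by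
        refine setLIntegral_mono' measurableSet_Ioi fun t (ht : 0 < t) => ?_
        rw [← ENNReal.ofReal_mul (by positivity)]
        refine ENNReal.ofReal_le_ofReal ?_
        calc _ ≤ ((Real.Gamma p)⁻¹ * t ^ (-(1 / 2) : ℝ)) * ((Real.pi / t) ^ (d / 2) *
              Real.exp (-(Real.pi ^ 2 * ‖ζ‖ ^ 2 / t))) := by
              gcongr; exact besselDensity_le hp hp1 ht
          _ = _ := by
              have : t ^ (-((d - 1) / 2) - 1) = t ^ (-(1 / 2) : ℝ) * (t ^ (d / 2))⁻¹ := by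
                rw [← Real.rpow_neg ht.le, ← Real.rpow_add ht]; ring_nf
              rw [this, Real.div_rpow Real.pi_pos.le ht.le]
              ring
    _ = _ := by
        rw [lintegral_const_mul' _ _ ENNReal.ofReal_ne_top,
          lintegral_rpow_mul_exp_neg_div (by linarith) (by positivity), mul_assoc,
          enorm_rpow_eq_ofReal hζ, ← ENNReal.ofReal_mul
            (mul_nonneg (by positivity) (Real.Gamma_nonneg_of_nonneg (by linarith)))]
        congr 2
        rw [Real.mul_rpow (by positivity) (by positivity), ← Real.rpow_natCast ‖ζ‖ 2,
          ← Real.rpow_mul hζp.le]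
        push_cast
        ring_nf

/-- The Fourier transform of a Bessel weight times a Schwartz function as a Gaussian mixture. -/
theorem fourier_bessel_mul (f : 𝓢(V, ℂ)) {p : ℝ} (hp : 0 < p) (ξ : V) :
    𝓕 (fun x => (((1 + ‖x‖ ^ 2) ^ (-p) : ℝ) : ℂ) * f x) ξ =
      ∫ t in Set.Ioi 0, (besselDensity p t : ℂ) *
        𝓕 (fun x => (Real.exp (-(t * ‖x‖ ^ 2)) : ℂ) * f x) ξ := by
  simp only [Real.fourier_eq', smul_eq_mul]
  have hint : Integrable (Function.uncurry fun (x : V) (t : ℝ) => (besselDensity p t : ℂ) *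
      (Complex.exp ((-2 * Real.pi * inner ℝ x ξ : ℝ) * Complex.I) *
        ((Real.exp (-(t * ‖x‖ ^ 2)) : ℂ) * f x)))
      (volume.prod (volume.restrict (Set.Ioi 0))) := by
    have h := f.integrable (μ := volume).mul_prod
      ((integrableOn_besselDensity hp).ofReal (𝕜 := ℂ))
    refine h.mono ?_ ?_
    · refine Measurable.aestronglyMeasurable ?_
      have := f.continuous.measurable
      unfold Function.uncurry
      fun_prop
    · have : ∀ᵐ z : V × ℝ ∂(volume.prod (volume.restrict (Set.Ioi 0))), z.2 ∈ Set.Ioi (0 : ℝ) :=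
        Measure.quasiMeasurePreserving_snd.ae (ae_restrict_mem measurableSet_Ioi)
      filter_upwards [this] with z hz
      have hz : 0 < z.2 := hz
      simp only [Function.uncurry, norm_mul, Complex.norm_exp_ofReal_mul_I, one_mul]
      rw [mul_comm ‖f z.1‖]
      refine mul_le_mul_of_nonneg_left (mul_le_of_le_one_left (norm_nonneg _) ?_) (norm_nonneg _)
      rw [Complex.norm_real, Real.norm_of_nonneg (Real.exp_pos _).le]
      exact Real.exp_le_one_iff.2 (by simpa using by positivity)
  have hswap := integral_integral_swap hint
  simp only [integral_const_mul] at hswap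
  rw [← hswap]
  refine integral_congr_ae (.of_forall fun x => ?_)
  simp only
  rw [← integral_besselDensity_mul_exp hp (sq_nonneg ‖x‖), ← integral_complex_ofReal,
    ← integral_mul_const, ← integral_const_mul]
  refine integral_congr_ae (.of_forall fun t => ?_)
  simp only
  push_cast
  ring

/-- The Fourier transform of a Bessel weight times a Schwartz function is controlled by a Riesz
potential of order one. -/
theorem exists_enorm_fourier_bessel_mul_le {p : ℝ} (hd : 2 ≤ Module.finrank ℝ V) (hp : 1 / 2 ≤ p)
    (hp1 : p ≤ 1) :
    ∃ C : ℝ≥0∞, C ≠ ∞ ∧ ∀ (f : 𝓢(V, ℂ)) (ξ : V),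
      ‖𝓕 (fun x => (((1 + ‖x‖ ^ 2) ^ (-p) : ℝ) : ℂ) * f x) ξ‖ₑ ≤
        C * ∫⁻ η, ‖ξ - η‖ₑ ^ (-(Module.finrank ℝ V - 1) : ℝ) * ‖𝓕 (f : V → ℂ) η‖ₑ := by
  have : Nontrivial V := Module.nontrivial_of_finrank_pos (R := ℝ) (by omega)
  obtain ⟨C, hC, h⟩ := exists_lintegral_besselDensity_mul_gaussian_le (V := V)
    (d := Module.finrank ℝ V) (by exact_mod_cast hd) hp hp1
  refine ⟨C, hC, fun f ξ => ?_⟩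
  have hfm : Measurable (𝓕 (f : V → ℂ)) := by
    rw [← SchwartzMap.fourier_coe]; exact (𝓕 f).continuous.measurable
  have hξ : ∀ᵐ η : V, η ≠ ξ := by simp [ae_iff, measure_singleton]
  rw [fourier_bessel_mul f (by linarith) ξ]
  calc _ ≤ ∫⁻ t in Set.Ioi 0, ∫⁻ η : V, ENNReal.ofReal (besselDensity p t *
        ((Real.pi / t) ^ ((Module.finrank ℝ V : ℝ) / 2) *
        Real.exp (-(Real.pi ^ 2 * ‖ξ - η‖ ^ 2 / t)))) * ‖𝓕 (f : V → ℂ) η‖ₑ := by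
        refine (enorm_integral_le_lintegral_enorm _).trans ?_
        refine setLIntegral_mono' measurableSet_Ioi fun t (ht : 0 < t) => ?_
        rw [fourier_gaussian_mul f ht, ← integral_const_mul]
        refine (enorm_integral_le_lintegral_enorm _).trans (lintegral_mono fun η => ?_)
        have hb := besselDensity_nonneg (show 0 < p by linarith) ht
        rw [← mul_assoc, ← Complex.ofReal_mul, enorm_mul, ← ofReal_norm (Complex.ofReal _),
          Complex.norm_real, Real.norm_of_nonneg (by positivity)]
    _ = ∫⁻ η : V, (∫⁻ t in Set.Ioi 0, ENNReal.ofReal (besselDensity p t *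
        ((Real.pi / t) ^ ((Module.finrank ℝ V : ℝ) / 2) *
        Real.exp (-(Real.pi ^ 2 * ‖ξ - η‖ ^ 2 / t))))) * ‖𝓕 (f : V → ℂ) η‖ₑ := by
        rw [lintegral_lintegral_swap (Measurable.aemeasurable (by unfold Function.uncurry; fun_prop))]
        refine lintegral_congr fun η => ?_
        rw [lintegral_mul_const' _ _ (by finiteness)]
    _ ≤ ∫⁻ η : V, C * (‖ξ - η‖ₑ ^ (-(Module.finrank ℝ V - 1) : ℝ) * ‖𝓕 (f : V → ℂ) η‖ₑ) := by
        refine lintegral_mono_ae ?_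
        filter_upwards [hξ] with η hη
        rw [← mul_assoc]
        gcongr
        exact h (ξ - η) (sub_ne_zero.2 hη.symm)
    _ = _ := lintegral_const_mul' _ _ hC
end

section
variable {V : Type*} [NormedAddCommGroup V] [InnerProductSpace ℝ V] [FiniteDimensional ℝ V]
  [MeasurableSpace V] [BorelSpace V]

/-- A locally integrable power of the norm times a bounded integrable function is integrable. -/
theorem integrable_norm_rpow_mul [Nontrivial V] {s M : ℝ} (hs : -(Module.finrank ℝ V : ℝ) < s)
    (hs0 : s ≤ 0) {φ : V → ℂ} (hφ : Integrable φ) (hM : ∀ x, ‖φ x‖ ≤ M) :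
    Integrable (fun ξ => ((‖ξ‖ ^ s : ℝ) : ℂ) * φ ξ) := by
  have hd : 1 ≤ Module.finrank ℝ V := Module.finrank_pos
  have hm : AEStronglyMeasurable (fun ξ => ((‖ξ‖ ^ s : ℝ) : ℂ) * φ ξ) volume := by
    refine AEStronglyMeasurable.mul ?_ hφ.1
    exact (Complex.measurable_ofReal.comp (measurable_norm.pow_const s)).aestronglyMeasurable
  rw [← integrableOn_univ, ← Set.union_compl_self (Metric.ball (0 : V) 1), integrableOn_union]
  constructor
  · refine integrableOn_ball_of_norm_le_rpow (C := M) (α := -s) hd (by linarith)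
      (.of_forall fun x => ?_) hm
    rw [norm_mul, Complex.norm_real, Real.norm_of_nonneg (by positivity), neg_neg, mul_comm]
    gcongr
    exact hM x
  · refine Integrable.mono (g := φ) hφ.integrableOn hm.restrict ?_
    filter_upwards [ae_restrict_mem measurableSet_ball.compl] with x hx
    have hx : 1 ≤ ‖x‖ := by simpa using hx
    rw [norm_mul, Complex.norm_real, Real.norm_of_nonneg (by positivity)]
    exact mul_le_of_le_one_left (norm_nonneg _) (Real.rpow_le_one_of_one_le_of_nonpos hx hs0)

theorem memLp_two_norm_rpow_mul [Nontrivial V] {s M : ℝ}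
    (hs : -(Module.finrank ℝ V : ℝ) < 2 * s)
    (hs0 : s ≤ 0) {φ : V → ℂ} (hφ : Integrable φ) (hM : ∀ x, ‖φ x‖ ≤ M) :
    MemLp (fun ξ => ((‖ξ‖ ^ s : ℝ) : ℂ) * φ ξ) 2 := by
  have hm : AEStronglyMeasurable (fun ξ => ((‖ξ‖ ^ s : ℝ) : ℂ) * φ ξ) volume :=
    (integrable_norm_rpow_mul (by linarith) hs0 hφ hM).1
  rw [memLp_two_iff_integrable_sq_norm hm]
  have h2 : Integrable (fun x => φ x * φ x) :=
    hφ.bdd_mul hφ.1 (.of_forall hM)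
  have h := (integrable_norm_rpow_mul (M := M * M) hs (by linarith) h2 fun x => by
    rw [norm_mul]
    exact mul_le_mul (hM x) (hM x) (norm_nonneg _) ((norm_nonneg _).trans (hM x))).norm
  refine h.congr (.of_forall fun x => ?_)
  simp only [norm_mul, Complex.norm_real, Real.norm_of_nonneg (Real.rpow_nonneg (norm_nonneg x) _)]
  rw [mul_comm 2 s, Real.rpow_mul (norm_nonneg _), Real.rpow_two]
  ring

theorem eLpNorm_two_norm_rpow_mul [Nontrivial V] (s : ℝ) (φ : V → ℂ) :
    eLpNorm (fun ξ => ((‖ξ‖ ^ s : ℝ) : ℂ) * φ ξ) 2 =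
      (∫⁻ ξ, ‖ξ‖ₑ ^ (2 * s) * ‖φ ξ‖ₑ ^ (2 : ℝ)) ^ (1 / 2 : ℝ) := by
  rw [eLpNorm_eq_lintegral_rpow_enorm_toReal (by norm_num) (by norm_num)]
  simp only [ENNReal.toReal_ofNat]
  congr 1
  have h0 : ∀ᵐ x : V, x ≠ 0 := by simp [ae_iff, measure_singleton]
  refine lintegral_congr_ae ?_
  filter_upwards [h0] with x hx
  rw [enorm_mul, ENNReal.mul_rpow_of_nonneg _ _ (by norm_num), mul_comm 2 s, ENNReal.rpow_mul,
    enorm_rpow_eq_ofReal hx, ← ofReal_norm (Complex.ofReal _), Complex.norm_real,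
    Real.norm_of_nonneg (by positivity)]

end

theorem eLpNorm_absD {n : ℕ} (hn : 1 ≤ n) {s : ℝ} (hs : -(n : ℝ) < 2 * s) (hs0 : s ≤ 0)
    (f : 𝓢(EuclideanSpace ℝ (Fin n), ℂ)) :
    eLpNorm (absD s (fun x => f x)) 2 volume =
      (∫⁻ ξ, ‖ξ‖ₑ ^ (2 * s) * ‖𝓕 (f : EuclideanSpace ℝ (Fin n) → ℂ) ξ‖ₑ ^ (2 : ℝ)) ^
        (1 / 2 : ℝ) := by
  have : Nontrivial (EuclideanSpace ℝ (Fin n)) :=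
    Module.nontrivial_of_finrank_pos (R := ℝ) (by simpa using by omega)
  have hφ : Integrable (𝓕 (f : EuclideanSpace ℝ (Fin n) → ℂ)) := by
    rw [← SchwartzMap.fourier_coe]; exact (𝓕 f).integrable
  obtain ⟨M, -, hM⟩ := (𝓕 f).decay 0 0
  have hM : ∀ x, ‖𝓕 (f : EuclideanSpace ℝ (Fin n) → ℂ) x‖ ≤ M := fun x => by
    rw [← SchwartzMap.fourier_coe]; simpa using hM x
  rw [absD, eLpNorm_fourierInv_eq, eLpNorm_two_norm_rpow_mul]
  · exact integrable_norm_rpow_mul (by rw [finrank_euclideanSpace_fin]; linarith) hs0 hφ hM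
  · exact memLp_two_norm_rpow_mul (by rwa [finrank_euclideanSpace_fin]) hs0 hφ hM

/-- For `n ≥ 3`, `0 < δ ≤ 1`, there is `η = η(n,δ) > 0` such that for all Schwartz `f`:
`‖ |D|^{(3−n)/2 − 1} (⟨x⟩^{−1−δ} f) ‖_{L²} ≤ η ‖ |D|^{(3−n)/2} f ‖_{L²}`. -/
theorem stmt_16 (n : ℕ) (hn : 3 ≤ n) (δ : ℝ) (hδ0 : 0 < δ) (hδ1 : δ ≤ 1) :
    ∃ η > (0 : ℝ), ∀ f : SchwartzMap (EuclideanSpace ℝ (Fin n)) ℂ,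
      eLpNorm (absD ((3 - (n : ℝ)) / 2 - 1)
          (fun x => ((Real.sqrt (1 + ‖x‖ ^ 2) ^ (-(1 + δ)) : ℝ) : ℂ) * f x)) 2 volume
        ≤ ENNReal.ofReal η *
          eLpNorm (absD ((3 - (n : ℝ)) / 2) (fun x => f x)) 2 volume := by
  have hfin : Module.finrank ℝ (EuclideanSpace ℝ (Fin n)) = n := finrank_euclideanSpace_fin
  have hn' : (3 : ℝ) ≤ n := by exact_mod_cast hn
  obtain ⟨C₁, hC₁, h₁⟩ := exists_enorm_fourier_bessel_mul_le
    (V := EuclideanSpace ℝ (Fin n)) (p := (1 + δ) / 2) (by omega) (by linarith) (by linarith)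
  obtain ⟨C₂, hC₂, h₂⟩ := exists_lintegral_sq_rieszPotential_le
    (V := EuclideanSpace ℝ (Fin n)) (by omega)
  rw [hfin] at h₁ h₂
  set K : ℝ≥0∞ := (C₁ ^ (2 : ℝ) * C₂) ^ (1 / 2 : ℝ) with hK
  have hKtop : K ≠ ∞ := by finiteness
  refine ⟨K.toReal + 1, by positivity, fun f => ?_⟩
  have hKle : K ≤ ENNReal.ofReal (K.toReal + 1) := by
    rw [← ENNReal.ofReal_toReal hKtop, ENNReal.toReal_ofReal ENNReal.toReal_nonneg]
    exact ENNReal.ofReal_le_ofReal (by linarith)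
  let w : EuclideanSpace ℝ (Fin n) → ℂ := fun x => (((1 + ‖x‖ ^ 2) ^ (-((1 + δ) / 2)) : ℝ) : ℂ)
  have hw : w.HasTemperateGrowth :=
    Function.HasTemperateGrowth.comp Function.Complex.hasTemperateGrowth_ofReal
      (Function.hasTemperateGrowth_one_add_norm_sq_rpow _ _)
  have hg : ∀ x, SchwartzMap.smulLeftCLM ℂ w f x =
      (((1 + ‖x‖ ^ 2) ^ (-((1 + δ) / 2)) : ℝ) : ℂ) * f x := fun x => by
    rw [SchwartzMap.smulLeftCLM_apply_apply hw, smul_eq_mul]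
  have hsqrt : (fun x => ((Real.sqrt (1 + ‖x‖ ^ 2) ^ (-(1 + δ)) : ℝ) : ℂ) * f x) =
      fun x => SchwartzMap.smulLeftCLM ℂ w f x := by
    ext x
    rw [hg, Real.sqrt_eq_rpow, ← Real.rpow_mul (by positivity)]
    ring_nf
  rw [hsqrt, eLpNorm_absD (by omega) (by linarith) (by linarith),
    eLpNorm_absD (by omega) (by linarith) (by linarith), funext hg]
  refine le_trans ?_ (mul_le_mul_left hKle _)
  rw [hK, ← ENNReal.mul_rpow_of_nonneg _ _ (by norm_num)]
  gcongr
  have hfm : Measurable (𝓕 (f : EuclideanSpace ℝ (Fin n) → ℂ)) := by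
    rw [← SchwartzMap.fourier_coe]; exact (𝓕 f).continuous.measurable
  rw [show 2 * ((3 - (n : ℝ)) / 2 - 1) = 1 - n by ring,
    show 2 * ((3 - (n : ℝ)) / 2) = 3 - n by ring]
  calc _ ≤ ∫⁻ ξ : EuclideanSpace ℝ (Fin n), C₁ ^ (2 : ℝ) * (‖ξ‖ₑ ^ (1 - n : ℝ) *
        (∫⁻ η, ‖ξ - η‖ₑ ^ (-(n - 1) : ℝ) *
          ‖𝓕 (f : EuclideanSpace ℝ (Fin n) → ℂ) η‖ₑ) ^ (2 : ℝ)) := by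
        refine lintegral_mono fun ξ => ?_
        rw [mul_left_comm, ← ENNReal.mul_rpow_of_nonneg _ _ (by norm_num)]
        gcongr
        exact h₁ f ξ
    _ ≤ _ := by
        rw [lintegral_const_mul' _ _ (by finiteness), mul_assoc]
        gcongr
        exact h₂ _ hfm.enorm
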